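/- For every 2-colouring of the natural numbers, there exist infinitely many monochromatic solutions to x + y = z², i.e., triples (x, y, z) with x + y = z² where x, y, z all receive the same colour. -/

import Mathlib

/-- A set closed under adding `d = 2a+1` modulo `2(a+b+1)` and under adding `2` contains `a+1`
whenever it contains `a`. -/
lemma succ_of_closed_mod {Q : ℕ → Prop} {a b : ℕ}
    (hmod : ∀ u, Q (u + 2 * (a + b + 1)) → Q u)
    (hd : ∀ u, Q u → Q (u + (2 * a + 1))) (h2 : ∀ u, Q u → Q (u + 2)) (ha : Q a) :
    Q (a + 1) := by
  have h2n : ∀ n u, Q u → Q (u + 2 * n) := by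
    intro n
    induction n with
    | zero => intro u hu; exact hu
    | succ k ih => intro u hu; exact h2 _ (ih u hu)
  have h := h2n (b + 1) _ (hd a ha)
  apply hmod
  convert h using 1
  ring

/-- If `a` has a property `P`, the numbers in `[a+1, b]` do not and `b+1` does, where `b` is at most
about `(a+1)²/2`, then some `x + y = z²` with `z ≥ N` is monochromatic with respect to `P`. -/
lemma false_of_short_run {P : ℕ → Prop} {N a b : ℕ}
    (hP : ∀ x y z, N ≤ z → x + y = z ^ 2 → P x → P y → ¬ P z)
    (hnP : ∀ x y z, N ≤ z → x + y = z ^ 2 → ¬ P x → ¬ P y → P z)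
    (hNa : N ≤ a) (hab : a < b) (ha : P a) (hb : P (b + 1))
    (hrun : ∀ w, a < w → w ≤ b → ¬ P w) (hshort : 2 * (a + b + 1) ≤ (a + 1) ^ 2) : False := by
  have up : ∀ w x, a < w → w ≤ b → x ≤ a ^ 2 → P x → P (x + (w ^ 2 - a ^ 2)) := by
    intro w x h1 h2 hx hPx
    have hw : a ^ 2 ≤ w ^ 2 := Nat.pow_le_pow_left h1.le 2
    by_contra h
    exact hrun w h1 h2 (hnP (a ^ 2 - x) (x + (w ^ 2 - a ^ 2)) w (by omega) (by omega)
      (fun h' => hP x (a ^ 2 - x) a hNa (by omega) hPx h' ha) h)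
  have down : ∀ x, x + (2 * b + 1) ≤ (b + 1) ^ 2 → P (x + (2 * b + 1)) → P x := by
    intro x hx hPx
    have hsq : (b + 1) ^ 2 = b ^ 2 + (2 * b + 1) := by ring
    by_contra h
    exact hrun b hab le_rfl (hnP x (b ^ 2 - x) b (by omega) (by omega) h
      (fun h' => hP _ _ (b + 1) (by omega) (by omega) hPx h' hb))
  have hSb : (a + 1) ^ 2 ≤ b ^ 2 := Nat.pow_le_pow_left hab 2
  have hsqa : (a + 1) ^ 2 = a ^ 2 + (2 * a + 1) := by ring
  have hsqb : (b + 1) ^ 2 = b ^ 2 + (2 * b + 1) := by ring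
  have upd : ∀ x, x ≤ a ^ 2 → P x → P (x + (2 * a + 1)) := by
    intro x hx hPx
    have := up (a + 1) x (by omega) (by omega) hx hPx
    rwa [show (a + 1) ^ 2 - a ^ 2 = 2 * a + 1 by omega] at this
  have downq : ∀ q x, x + (2 * b + 1) * q ≤ (b + 1) ^ 2 → P (x + (2 * b + 1) * q) → P x := by
    intro q
    induction q with
    | zero => intro x _ h; exact h
    | succ k ih =>
      intro x hx h
      rw [mul_add, mul_one, ← add_assoc] at hx h
      exact ih x (by omega) (down _ hx h)
  set M := 2 * (a + b + 1) with hM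
  have hMpos : 0 < M := by omega
  have hd : ∀ u, P (u % M) → P ((u + (2 * a + 1)) % M) := by
    intro u hu
    have hlt := Nat.mod_lt u hMpos
    rw [← Nat.mod_add_mod]
    rcases lt_or_ge (u % M) (2 * b + 1) with h | h
    · rw [Nat.mod_eq_of_lt (by omega)]
      exact upd _ (by omega) hu
    · rw [Nat.mod_eq_sub_mod (by omega), Nat.mod_eq_of_lt (by omega)]
      apply down
      · omega
      · rwa [show u % M + (2 * a + 1) - M + (2 * b + 1) = u % M by omega]
  have hdn : ∀ n u, P (u % M) → P ((u + (2 * a + 1) * n) % M) := by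
    intro n
    induction n with
    | zero => intro u hu; exact hu
    | succ k ih =>
      intro u hu
      rw [mul_add, mul_one, ← add_assoc]
      exact hd _ (ih u hu)
  have hdcancel : ∀ n u, P ((u + (2 * a + 1) * n) % M) → P (u % M) := by
    intro n u hu
    have h := hdn ((M - 1) * n) _ hu
    obtain ⟨m, hm⟩ : ∃ m, M = m + 1 := ⟨M - 1, by omega⟩
    rw [show u + (2 * a + 1) * n + (2 * a + 1) * ((M - 1) * n) = u + M * ((2 * a + 1) * n) by
      rw [hm, Nat.add_sub_cancel]; ring, Nat.add_mul_mod_self_left] at h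
    exact h
  have reduce : ∀ v, v ≤ (b + 1) ^ 2 → P v → P (v % M) := by
    intro v hv hPv
    have hdm := Nat.mod_add_div v (2 * b + 1)
    have hr : P (v % (2 * b + 1)) := downq (v / (2 * b + 1)) _ (by omega) (by rwa [hdm])
    have hlt := Nat.mod_lt v (show 0 < 2 * b + 1 by omega)
    apply hdcancel (v / (2 * b + 1))
    have : v + (2 * a + 1) * (v / (2 * b + 1)) = v % (2 * b + 1) + M * (v / (2 * b + 1)) := by
      nth_rewrite 1 [← hdm]
      rw [hM]
      ring
    rw [this, Nat.add_mul_mod_self_left, Nat.mod_eq_of_lt (by omega)]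
    exact hr
  have h2 : ∀ u, P (u % M) → P ((u + 2) % M) := by
    rcases (show b = a + 1 ∨ a + 2 ≤ b by omega) with rfl | hab2
    · intro u hu
      apply hdcancel 2
      rw [show u + 2 + (2 * a + 1) * 2 = u + M by omega, Nat.add_mod_right]
      exact hu
    · have hsmall : ∀ y, y < 2 * b + 1 → P y → P ((y + 2) % M) := by
        intro y hy hPy
        have hsq2 : (a + 2) ^ 2 = a ^ 2 + (4 * a + 4) := by ring
        have hle : (a + 2) ^ 2 ≤ b ^ 2 := Nat.pow_le_pow_left hab2 2
        have h := up (a + 2) y (by omega) hab2 (by omega) hPy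
        apply hdcancel 2
        rw [show y + 2 + (2 * a + 1) * 2 = y + ((a + 2) ^ 2 - a ^ 2) by omega]
        exact reduce _ (by omega) h
      intro u hu
      have hlt := Nat.mod_lt u hMpos
      rw [← Nat.mod_add_mod]
      rcases lt_or_ge (u % M) (2 * b + 1) with h | h
      · exact hsmall _ h hu
      · have := hsmall (u % M - (2 * b + 1)) (by omega)
          (down _ (by omega) (by rwa [Nat.sub_add_cancel h]))
        apply hdcancel 1
        rw [show u % M + 2 + (2 * a + 1) * 1 = u % M - (2 * b + 1) + 2 + M by omega,
          Nat.add_mod_right]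
        exact this
  have key := succ_of_closed_mod (Q := fun u => P (u % M)) (a := a) (b := b)
    (fun u hu => by simpa [← hM] using hu) hd h2
    (by rwa [Nat.mod_eq_of_lt (by omega)])
  simp only [Nat.mod_eq_of_lt (show a + 1 < M by omega)] at key
  exact hrun (a + 1) (by omega) hab key

/-- The complementary case of `false_of_short_run`: a run `[a+1, b]` with `b` at least about
`(a+1)²/2` also forces a monochromatic solution. -/
lemma false_of_long_run {P : ℕ → Prop} {N a b : ℕ}
    (hP : ∀ x y z, N ≤ z → x + y = z ^ 2 → P x → P y → ¬ P z)
    (hnP : ∀ x y z, N ≤ z → x + y = z ^ 2 → ¬ P x → ¬ P y → P z)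
    (hNa : N ≤ a) (ha : 100 ≤ a)
    (hrun : ∀ w, a < w → w ≤ b → ¬ P w) (hlong : (a + 1) ^ 2 < 2 * (a + b + 1)) : False := by
  have hS : 101 * (a + 1) ≤ (a + 1) ^ 2 := by nlinarith
  have hab : a + 1 ≤ b := by omega
  have compl : ∀ p z y, a < p → p ≤ b → a < z → z ≤ b → p + y = z ^ 2 → P y := by
    intro p z y hp hp' hz hz' h
    by_contra hy
    exact hrun z hz hz' (hnP p y z (by omega) h (hrun p hp hp') hy)
  set S := (a + 1) ^ 2 with hSdef
  rcases le_or_gt (S + 1) (2 * b) with h | h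
  · exact hrun (S - S / 2) (by omega) (by omega)
      (compl (S / 2) (a + 1) _ (by omega) (by omega) (by omega) hab (by omega))
  · obtain ⟨t, ht1, ht2⟩ : ∃ t, S - b ≤ 5 * t ∧ 5 * t ≤ S - b + 5 :=
      ⟨(S - b) / 5 + 1, by omega, by omega⟩
    have hz : P (5 * t) :=
      compl (S - 5 * t) (a + 1) _ (by omega) (by omega) (by omega) hab (by omega)
    have hx : P (9 * t ^ 2 + 3 * t + 1) :=
      compl (3 * t) (3 * t + 1) _ (by omega) (by omega) (by omega) (by omega) (by ring)
    have hle : 3 * t + 1 ≤ 16 * t ^ 2 := by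
      have : 1 ≤ t := by omega
      nlinarith
    have hy : P (16 * t ^ 2 - (3 * t + 1)) :=
      compl (3 * t + 1) (4 * t) _ (by omega) (by omega) (by omega) (by omega) (by
        rw [Nat.add_sub_cancel' hle]; ring)
    refine hP _ _ (5 * t) (by omega) ?_ hx hy hz
    have : (5 * t) ^ 2 = 25 * t ^ 2 := by ring
    omega

/-- Every 2-colouring of ℕ has infinitely many monochromatic solutions to x + y = z². -/
theorem infinitely_many_mono_solutions (c : ℕ → Fin 2) :
    {t : ℕ × ℕ × ℕ | t.1 + t.2.1 = t.2.2 ^ 2 ∧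
      c t.1 = c t.2.1 ∧ c t.2.1 = c t.2.2}.Infinite := by
  intro hfin
  obtain ⟨B, hB⟩ := (hfin.image fun t => t.2.2).bddAbove
  have H : ∀ x y z, B + 1 ≤ z → x + y = z ^ 2 → c x = c y → c y ≠ c z := by
    intro x y z hz h h1 h2
    have : z ≤ B := hB ⟨(x, y, z), ⟨h, h1, h2⟩, rfl⟩
    omega
  have change : ∀ K, ∃ k, K ≤ k ∧ c k ≠ c (k + 1) := by
    intro K
    by_contra! hK
    have hconst : ∀ k, K ≤ k → c k = c K := by
      intro k hk
      induction k, hk using Nat.le_induction with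
      | base => rfl
      | succ n hn ih => rw [← hK n hn, ih]
    set z := K + B + 2 with hz
    have hzz : 2 * z ≤ z ^ 2 := by nlinarith
    apply H z (z ^ 2 - z) z (by omega) (by omega)
    · exact (hconst z (by omega)).trans (hconst (z ^ 2 - z) (by omega)).symm
    · exact (hconst (z ^ 2 - z) (by omega)).trans (hconst z (by omega)).symm
  obtain ⟨a, haK, ha⟩ := change (B + 100)
  classical
  have hex := change (a + 1)
  obtain ⟨hab, hb⟩ := Nat.find_spec hex
  have hmin := fun m => Nat.find_min (m := m) hex
  set b := Nat.find hex
  have hrun : ∀ w, a + 1 ≤ w → w ≤ b → c w = c (a + 1) := by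
    intro w hw
    induction w, hw using Nat.le_induction with
    | base => intro _; rfl
    | succ n hn ih =>
      intro hnb
      have := hmin n (by omega)
      push Not at this
      rw [← this hn, ih (by omega)]
  have two : ∀ i j k : Fin 2, i ≠ k → j ≠ k → i = j := by decide
  have hrun' : ∀ w, a < w → w ≤ b → ¬ c w = c a := by
    intro w hw hwb h
    exact ha (h.symm.trans (hrun w hw hwb))
  have hb' : c (b + 1) = c a :=
    two _ _ (c (a + 1)) (by rw [← hrun b hab le_rfl]; exact hb.symm) ha
  have hP : ∀ x y z, B + 1 ≤ z → x + y = z ^ 2 → c x = c a → c y = c a → ¬ c z = c a :=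
    fun x y z hz h hx hy hz' => H x y z hz h (hx.trans hy.symm) (hy.trans hz'.symm)
  have hnP : ∀ x y z, B + 1 ≤ z → x + y = z ^ 2 → ¬ c x = c a → ¬ c y = c a → c z = c a := by
    intro x y z hz h hx hy
    by_contra hz'
    exact H x y z hz h (two _ _ _ hx hy) (two _ _ _ hy hz')
  rcases le_or_gt (2 * (a + b + 1)) ((a + 1) ^ 2) with h | h
  · exact false_of_short_run (P := fun n => c n = c a) hP hnP (by omega) hab rfl hb' hrun' h
  · exact false_of_long_run (P := fun n => c n = c a) hP hnP (by omega) (by omega) hrun' h
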